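/- Consider the example system and the space-time process (Ŝ,ŵ⁰,ŵ,ŷ⁰,ŷ) with Ŝ = √2, (ŵ⁰,ŵ¹,ŵ²) = (√2/2,−√2/2,0) constant, ŷ⁰(s) = √2 s/2 and ŷ(s) = (1−√2 s/2, 0, 0, 0, √2 s/2). There is no multiplier (p₀,p,λ) ≠ (0,0,0), with p₀ ∈ ℝ, p : [0,√2] → ℝ⁵ absolutely continuous, λ ≥ 0, satisfying simultaneously: the adjoint equation dp/ds = −p·(Df(ŷ)ŵ⁰ + Dg₁(ŷ)ŵ¹ + Dg₂(ŷ)ŵ²) a.e.; the non-transversality condition (p₀,p(√2)) ∈ −λDΨ(ŷ(√2)) − N with N the polar cone of {1}×𝔗 at (1,(0,0,0,0,1)); the maximization condition and the vanishing of the maximized Hamiltonian and of p·gᵢ(ŷ) (i=1,2) on [0,√2]; and the higher-order condition p(s)·B(ŷ(s)) = 0 for all s ∈ [0,√2] and every iterated Lie bracket B of g₁,g₂ (in particular for B = [[g₁,g₂],g₂]). -/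

import Mathlib

open MeasureTheory Set
open scoped RealInnerProductSpace

noncomputable section

/-- `ℝⁿ` with the Euclidean norm. -/
abbrev E (n : ℕ) : Type := EuclideanSpace ℝ (Fin n)

/-- The vector `(a,b,c,d,e) ∈ ℝ⁵`. -/
def vec5 (a b c d e : ℝ) : E 5 := (WithLp.equiv 2 (Fin 5 → ℝ)).symm ![a, b, c, d, e]

/-- The vector `(a,b) ∈ ℝ²`. -/
def vec2 (a b : ℝ) : E 2 := (WithLp.equiv 2 (Fin 2 → ℝ)).symm ![a, b]

/-- The drift `f(x) = ½((x²)² + (x³)² + (1−x¹−x⁵)²) e₄ + e₅` of the example. -/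
def fEx (x : E 5) : E 5 :=
  vec5 0 0 0 (((x 1) ^ 2 + (x 2) ^ 2 + (1 - x 0 - x 4) ^ 2) / 2) 1

/-- The control vector field `g₁(x) = e₁ − ½(x²)² e₃` of the example. -/
def g1Ex (x : E 5) : E 5 := vec5 1 0 (-(x 1) ^ 2 / 2) 0 0

/-- The control vector field `g₂(x) = e₂` of the example. -/
def g2Ex (_ : E 5) : E 5 := vec5 0 1 0 0 0

/-- The pair of control vector fields of the example. -/
def gEx : Fin 2 → E 5 → E 5 := ![g1Ex, g2Ex]

/-- The initial point `x̌ = (1,0,0,0,0)` of the example. -/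
def xInit : E 5 := vec5 1 0 0 0 0

/-- The target `𝔗 = {x ∈ ℝ⁵ : x¹ = x² = 0, x³ ≥ −1}` of the example. -/
def TT : Set (E 5) := {x | x 0 = 0 ∧ x 1 = 0 ∧ -1 ≤ x 2}

/-- A space-time process of the extended system of the example:
`dy⁰/ds = w⁰`, `dy/ds = f(y)w⁰ + g₁(y)w¹ + g₂(y)w²`, `(y⁰,y)(0) = (0,x̌)`, with
`(w⁰,w) ∈ L^∞([0,S],𝒲)`, `𝒲 = {w⁰ ≥ 0, w⁰ + |w| = 1}`. -/
def IsSpaceTimeProcessEx (S : ℝ) (w0 : ℝ → ℝ) (w : ℝ → E 2) (y0 : ℝ → ℝ) (y : ℝ → E 5) :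
    Prop :=
  0 < S ∧ AEMeasurable w0 (volume.restrict (Icc 0 S)) ∧
  AEMeasurable w (volume.restrict (Icc 0 S)) ∧
  (∀ s ∈ Icc (0:ℝ) S, 0 ≤ w0 s ∧ w0 s + ‖w s‖ = 1) ∧
  ContinuousOn y (Icc 0 S) ∧
  IntegrableOn (fun σ => w0 σ • fEx (y σ) + ∑ i, w σ i • gEx i (y σ)) (Icc 0 S) ∧
  (∀ s ∈ Icc (0:ℝ) S, y0 s = ∫ σ in (0:ℝ)..s, w0 σ) ∧
  (∀ s ∈ Icc (0:ℝ) S, y s = xInit + ∫ σ in (0:ℝ)..s,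
    (w0 σ • fEx (y σ) + ∑ i, w σ i • gEx i (y σ)))

/-- The unmaximized Hamiltonian of the example. -/
def HamEx (x : E 5) (p0 : ℝ) (p : E 5) (w0 : ℝ) (w : E 2) : ℝ :=
  p0 * w0 + ⟪p, w0 • fEx x + ∑ i, w i • gEx i x⟫

/-- The maximized Hamiltonian of the example. -/
def maxHamEx (x : E 5) (p0 : ℝ) (p : E 5) : ℝ :=
  sSup {h : ℝ | ∃ (w0 : ℝ) (w : E 2), 0 ≤ w0 ∧ w0 + ‖w‖ = 1 ∧ h = HamEx x p0 p w0 w}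

/-- The Lie bracket `[F₁,F₂](x) := DF₂(x)F₁(x) − DF₁(x)F₂(x)`. -/
def lieB (F₁ F₂ : E 5 → E 5) : E 5 → E 5 :=
  fun x => fderiv ℝ F₂ x (F₁ x) - fderiv ℝ F₁ x (F₂ x)

/-- The iterated Lie brackets of `g₁,g₂`. -/
inductive IsIterBracket : (E 5 → E 5) → Prop
  | base (i : Fin 2) : IsIterBracket (gEx i)
  | br {B₁ B₂ : E 5 → E 5} : IsIterBracket B₁ → IsIterBracket B₂ →
      IsIterBracket (lieB B₁ B₂)

lemma hasFDerivAt_coord (i : Fin 5) (x : E 5) :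
    HasFDerivAt (fun y : E 5 => y i) (EuclideanSpace.proj i : E 5 →L[ℝ] ℝ) x :=
  (EuclideanSpace.proj i : E 5 →L[ℝ] ℝ).hasFDerivAt

lemma fderiv_fEx_eq_zero {x : E 5} (h1 : x 1 = 0) (h2 : x 2 = 0) (h : 1 - x 0 - x 4 = 0) :
    fderiv ℝ fEx x = 0 := by
  have hf : fEx = fun y : E 5 =>
      (((y 1) ^ 2 + (y 2) ^ 2 + (1 - y 0 - y 4) ^ 2) / 2) • vec5 0 0 0 1 0 + vec5 0 0 0 0 1 := by
    funext y
    ext i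
    fin_cases i <;> simp [fEx, vec5]
  rw [hf]
  have hq := (((((hasFDerivAt_coord 1 x).pow 2).add ((hasFDerivAt_coord 2 x).pow 2)).add
    ((((hasFDerivAt_coord 0 x).const_sub 1).sub (hasFDerivAt_coord 4 x)).pow 2)).mul_const
    (2⁻¹ : ℝ)).smul_const (vec5 0 0 0 1 0)
  refine (hq.add_const (vec5 0 0 0 0 1)).fderiv.trans ?_
  simp [h1, h2, h]

lemma hasFDerivAt_g1Ex (x : E 5) :
    HasFDerivAt g1Ex
      ((-(x 1) • (EuclideanSpace.proj 1 : E 5 →L[ℝ] ℝ)).smulRight (vec5 0 0 1 0 0)) x := by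
  have hg : g1Ex = fun y : E 5 => (-(y 1) ^ 2 / 2) • vec5 0 0 1 0 0 + vec5 1 0 0 0 0 := by
    funext y
    ext i
    fin_cases i <;> simp [g1Ex, vec5]
  rw [hg]
  refine ((((((hasFDerivAt_coord 1 x).pow 2).neg.mul_const (2⁻¹ : ℝ)).smul_const
    (vec5 0 0 1 0 0)).add_const (vec5 1 0 0 0 0))).congr_fderiv ?_
  ext v i
  simp only [ContinuousLinearMap.smulRight_apply, smul_apply,
    neg_apply, PiLp.smul_apply, PiLp.proj_apply, smul_eq_mul, nsmul_eq_mul]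
  push_cast
  ring

lemma fderiv_g2Ex (x : E 5) : fderiv ℝ g2Ex x = 0 := by
  have hg : g2Ex = fun _ : E 5 => vec5 0 1 0 0 0 := rfl
  rw [hg, fderiv_const_apply]

lemma lieB_g1Ex_g2Ex : lieB g1Ex g2Ex = fun x => (x 1) • vec5 0 0 1 0 0 := by
  funext x
  simp [lieB, fderiv_g2Ex, (hasFDerivAt_g1Ex x).fderiv, g2Ex, vec5]

lemma lieB_lieB_g1Ex_g2Ex_g2Ex :
    lieB (lieB g1Ex g2Ex) g2Ex = fun _ => -vec5 0 0 1 0 0 := by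
  funext x
  have h := ((hasFDerivAt_coord 1 x).smul_const (vec5 0 0 1 0 0)).fderiv
  rw [lieB_g1Ex_g2Ex]
  simp only [lieB, fderiv_g2Ex, h]
  simp [g2Ex, vec5]

/-- along the extremal `(Ŝ,ŵ⁰,ŵ,ŷ⁰,ŷ)` (with `Ŝ = √2`) there is NO
non-zero multiplier `(p₀,p,λ)` satisfying simultaneously the adjoint equation, the
non-transversality condition, the maximization condition, the vanishing of the
Hamiltonians, and the higher-order condition `p·B(ŷ) ≡ 0` for every iterated Lie
bracket `B` of `g₁,g₂`. -/
theorem stmt13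
    (hatS : ℝ) (hS : hatS = Real.sqrt 2)
    (hatw0 : ℝ → ℝ) (hw0 : ∀ s, hatw0 s = Real.sqrt 2 / 2)
    (hatw : ℝ → E 2) (hw : ∀ s, hatw s = vec2 (-(Real.sqrt 2 / 2)) 0)
    (haty0 : ℝ → ℝ) (hy0 : ∀ s, haty0 s = Real.sqrt 2 * s / 2)
    (haty : ℝ → E 5)
    (hy : ∀ s, haty s = vec5 (1 - Real.sqrt 2 * s / 2) 0 0 0 (Real.sqrt 2 * s / 2)) :
    ¬ ∃ (p0 lam : ℝ) (p : ℝ → E 5),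
      0 ≤ lam ∧ ContinuousOn p (Icc 0 hatS) ∧
      -- non-triviality
      (¬ (p0 = 0 ∧ (∀ s ∈ Icc (0:ℝ) hatS, p s = 0) ∧ lam = 0)) ∧
      -- adjoint equation (in integral form)
      (∀ s ∈ Icc (0:ℝ) hatS, p s = p 0 - ∫ σ in (0:ℝ)..s,
        (hatw0 σ • (ContinuousLinearMap.adjoint (fderiv ℝ fEx (haty σ))) (p σ) +
         ∑ i, hatw σ i • (ContinuousLinearMap.adjoint (fderiv ℝ (gEx i) (haty σ))) (p σ))) ∧
      -- non-transversality
      (∃ a c₀ c₁ c₂ : ℝ, 0 ≤ a ∧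
        (-(haty hatS 2) - 1 ≠ 0 → a = 0) ∧
        ((p0, p hatS) : ℝ × E 5) =
          -(lam • (((0:ℝ), vec5 0 0 1 1 0) : ℝ × E 5)) -
          (a • (((0:ℝ), vec5 0 0 (-1) 0 0) : ℝ × E 5) +
           c₀ • (((1:ℝ), (0 : E 5)) : ℝ × E 5) +
           c₁ • (((0:ℝ), vec5 1 0 0 0 0) : ℝ × E 5) +
           c₂ • (((0:ℝ), vec5 0 1 0 0 0) : ℝ × E 5))) ∧
      -- first-order maximization
      (∀ᵐ s ∂(volume.restrict (Icc (0:ℝ) hatS)),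
        HamEx (haty s) p0 (p s) (hatw0 s) (hatw s) = maxHamEx (haty s) p0 (p s)) ∧
      -- vanishing of the Hamiltonians
      (∀ s ∈ Icc (0:ℝ) hatS, maxHamEx (haty s) p0 (p s) = 0) ∧
      (∀ s ∈ Icc (0:ℝ) hatS, ∀ i, ⟪p s, gEx i (haty s)⟫ = 0) ∧
      -- higher-order conditions
      (∀ B : E 5 → E 5, IsIterBracket B → ∀ s ∈ Icc (0:ℝ) hatS, ⟪p s, B (haty s)⟫ = 0) := by
  subst hS
  have hsq : (0 : ℝ) ≤ √2 := Real.sqrt_nonneg 2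
  rintro ⟨p0, lam, p, -, -, hne, hadj, ⟨a, c₀, c₁, c₂, -, ha, hend⟩, hmax, hham, hg, hB⟩
  have hdf (s : ℝ) : fderiv ℝ fEx (haty s) = 0 := by
    apply fderiv_fEx_eq_zero <;> simp [hy, vec5]
  have hdg (i : Fin 2) (s : ℝ) : fderiv ℝ (gEx i) (haty s) = 0 := by
    fin_cases i
    · refine (hasFDerivAt_g1Ex _).fderiv.trans ?_
      simp [hy, vec5]
    · exact fderiv_g2Ex _
  have hconst : ∀ s ∈ Icc (0 : ℝ) √2, p s = p 0 := fun s hs => by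
    rw [hadj s hs]
    simp [hdf, hdg]
  have hmem : √2 ∈ Icc (0 : ℝ) √2 := ⟨hsq, le_rfl⟩
  have ha0 : a = 0 := ha (by simp [hy, vec5])
  obtain ⟨-, hp⟩ := Prod.ext_iff.mp hend
  have hp : p √2 = vec5 (-c₁) (-c₂) (-lam) (-lam) 0 := by
    refine hp.trans ?_
    ext i
    fin_cases i <;> simp [vec5, ha0]
  have h3 := hB _ (.br (.br (.base 0) (.base 1)) (.base 1)) _ hmem
  change ⟪p √2, lieB (lieB g1Ex g2Ex) g2Ex (haty √2)⟫ = 0 at h3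
  rw [lieB_lieB_g1Ex_g2Ex_g2Ex, hp] at h3
  have hlam : lam = 0 := by simpa [vec5, PiLp.inner_apply, Fin.sum_univ_five] using h3
  have hc₁ : c₁ = 0 := by
    simpa [hp, hy, gEx, g1Ex, vec5, PiLp.inner_apply, Fin.sum_univ_five] using hg _ hmem 0
  have hc₂ : c₂ = 0 := by
    simpa [hp, gEx, g2Ex, vec5, PiLp.inner_apply, Fin.sum_univ_five] using hg _ hmem 1
  have hpend : p √2 = 0 := by
    rw [hp, hlam, hc₁, hc₂]
    ext i
    fin_cases i <;> simp [vec5]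
  have hpz : ∀ s ∈ Icc (0 : ℝ) √2, p s = 0 := fun s hs => by
    rw [hconst s hs, ← hconst _ hmem, hpend]
  refine hne ⟨?_, hpz, hlam⟩
  have : Filter.NeBot (ae (volume.restrict (Icc (0 : ℝ) √2))) := by
    rw [ae_neBot, Ne, Measure.restrict_eq_zero]
    simp
  obtain ⟨s, hs, hsm⟩ := (hmax.and (ae_restrict_mem measurableSet_Icc)).exists
  rw [hham s hsm, hpz s hsm, hw0] at hs
  simpa [HamEx] using hs
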